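/- The subspace I = ⊕_{k=1}^{p} I_k is a two-sided ideal of the (generally non-associative) algebra M: for all a ∈ I and b ∈ M, both a·b ∈ I and b·a ∈ I. -/

import Mathlib

open scoped TensorProduct DirectSum

noncomputable section

/-- The pure tensor `a₀ ⊗ a₁ ⊗ ⋯ ⊗ a_{m-1}` in the `m`-th tensor power. -/
def tp (A : Type) [AddCommGroup A] [Module ℂ A] (m : ℕ) (a : ℕ → A) : ⨂[ℂ]^m A :=
  PiTensorProduct.tprod ℂ (fun i : Fin m => a i.1)

/-- The space `M = ⊕_{k=1}^{p} A₁^{⊗k}`; the component of index `k : Fin p` is the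
tensor power of degree `k + 1`. -/
abbrev Mspace (p : ℕ) (A : Type) [AddCommGroup A] [Module ℂ A] : Type :=
  ⨁ k : Fin p, ⨂[ℂ]^(k.1 + 1) A

/-- Inclusion of the degree-`(k+1)` homogeneous component into `M`. -/
def incl (p : ℕ) (A : Type) [AddCommGroup A] [Module ℂ A] (k : Fin p) :
    (⨂[ℂ]^(k.1 + 1) A) →ₗ[ℂ] Mspace p A :=
  DirectSum.lof ℂ (Fin p) (fun k : Fin p => ⨂[ℂ]^(k.1 + 1) A) k

/-- The one-step substitution `id^{⊗r} ⊗ Γ ⊗ id^{⊗(n-2-r)}` followed by `Γ`, evaluated on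
a family of `2n−3` arguments; used to state the general associativity condition. -/
def gammaIns (n : ℕ) (A : Type) [AddCommGroup A] [Module ℂ A]
    (Γ : MultilinearMap ℂ (fun _ : Fin (n - 1) => A) A) (r : ℕ) (a : ℕ → A) : A :=
  Γ (fun i : Fin (n - 1) =>
    if i.1 < r then a i.1
    else if i.1 = r then Γ (fun j : Fin (n - 1) => a (r + j.1))
    else a (i.1 + (n - 2)))

/-- `mul` is the bilinear multiplication of `M = ⊕_{k=1}^{p} A₁^{⊗k}` determined on
homogeneous pure tensors `a = a₁⊗⋯⊗a_k`, `b = b₁⊗⋯⊗b_l` by: `a·b = a ⊗ b` if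
`k + l ≤ p`, and `a·b = Γ(a₁,…,a_k,b₁,…,b_{p+1−k}) ⊗ b_{p+2−k} ⊗ ⋯ ⊗ b_l` if
`k + l > p`. -/
def MulSpec (n p : ℕ) (A : Type) [AddCommGroup A] [Module ℂ A]
    (Γ : MultilinearMap ℂ (fun _ : Fin (n - 1) => A) A)
    (mul : Mspace p A →ₗ[ℂ] Mspace p A →ₗ[ℂ] Mspace p A) : Prop :=
  ∀ (k l : Fin p) (a b : ℕ → A),
    mul (incl p A k (tp A (k.1 + 1) a)) (incl p A l (tp A (l.1 + 1) b)) =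
      if h : (k.1 + 1) + (l.1 + 1) ≤ p then
        incl p A ⟨k.1 + l.1 + 1, by omega⟩
          (tp A (k.1 + l.1 + 1 + 1)
            (fun i => if i < k.1 + 1 then a i else b (i - (k.1 + 1))))
      else
        incl p A ⟨k.1 + l.1 + 1 - p, by have := k.isLt; have := l.isLt; omega⟩
          (tp A (k.1 + l.1 + 1 - p + 1)
            (fun i =>
              if i = 0 then
                Γ (fun j : Fin (n - 1) =>
                  if j.1 < k.1 + 1 then a j.1 else b (j.1 - (k.1 + 1)))
              else b (p - (k.1 + 1) + i)))

/-- The subspace `I_k ⊆ A₁^{⊗k}`: `I₁ = {0}`, and for `2 ≤ k ≤ p`,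
`I_k = {a : a·b = 0 for all b ∈ A₁^{⊗(p+1−k)}}`.  (The component of index `k : Fin p`
has degree `k + 1`.) -/
def Ik (p : ℕ) (A : Type) [AddCommGroup A] [Module ℂ A]
    (mul : Mspace p A →ₗ[ℂ] Mspace p A →ₗ[ℂ] Mspace p A) (k : Fin p) :
    Submodule ℂ (⨂[ℂ]^(k.1 + 1) A) :=
  if k.1 = 0 then ⊥
  else
    ⨅ y : ⨂[ℂ]^(p - (k.1 + 1) + 1) A,
      LinearMap.ker
        ((mul.flip (incl p A ⟨p - (k.1 + 1), by have := k.isLt; omega⟩ y)).comp (incl p A k))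

/-- The subspace `I = ⊕_{k=1}^{p} I_k ⊆ M`. -/
def Isub (p : ℕ) (A : Type) [AddCommGroup A] [Module ℂ A]
    (mul : Mspace p A →ₗ[ℂ] Mspace p A →ₗ[ℂ] Mspace p A) : Submodule ℂ (Mspace p A) :=
  ⨆ k : Fin p, (Ik p A mul k).map (incl p A k)

/-- `qM` is the bilinear form on `M` determined on homogeneous pure tensors
`a ∈ A₁^{⊗k}`, `b ∈ A₁^{⊗l}` by: `q(a,b) = 0` if `k + l ≢ 2 mod p`;
`q(a,b) = q₁(a₁, Γ(a₂,…,a_k,b₁,…,b_l))` if `k + l = n`; and `q(a,b) = q₁(a₁,b₁)` if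
`k = l = 1`. -/
def QSpec (n p : ℕ) (A : Type) [AddCommGroup A] [Module ℂ A]
    (Γ : MultilinearMap ℂ (fun _ : Fin (n - 1) => A) A)
    (q₁ : A →ₗ[ℂ] A →ₗ[ℂ] ℂ)
    (qM : Mspace p A →ₗ[ℂ] Mspace p A →ₗ[ℂ] ℂ) : Prop :=
  ∀ (k l : Fin p) (a b : ℕ → A),
    qM (incl p A k (tp A (k.1 + 1) a)) (incl p A l (tp A (l.1 + 1) b)) =
      if ((k.1 + 1) + (l.1 + 1)) % p = 2 % p then
        (if (k.1 + 1) + (l.1 + 1) = n then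
          q₁ (a 0) (Γ (fun j : Fin (n - 1) =>
            if j.1 + 1 < k.1 + 1 then a (j.1 + 1) else b (j.1 + 1 - (k.1 + 1))))
        else q₁ (a 0) (b 0))
      else 0

theorem aux_rep (A : Type) [AddCommGroup A] [Module ℂ A] (k : ℕ) (x : ⨂[ℂ]^(k+1) A) :
    ∃ (N : ℕ) (α : Fin N → ℕ → A), x = ∑ i, tp A (k+1) (α i) := by
  induction x using PiTensorProduct.induction_on with
  | smul_tprod r f =>
    refine ⟨1, fun _ j => if h : j < k+1 then Function.update f 0 (r • f 0) ⟨j, h⟩ else 0, ?_⟩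
    have h1 := (PiTensorProduct.tprod ℂ (s := fun _ : Fin (k+1) => A)).map_update_smul f 0 r (f 0)
    rw [Function.update_eq_self] at h1
    rw [← h1]
    simp only [Fin.sum_univ_one, Finset.univ_unique, Finset.sum_singleton, tp, Fin.is_lt, dite_true]
  | add x y hx hy =>
    obtain ⟨N, α, rfl⟩ := hx
    obtain ⟨N', α', rfl⟩ := hy
    refine ⟨N + N', Fin.append α α', ?_⟩
    rw [Fin.sum_univ_add]
    simp

theorem aux_proj (A : Type) [AddCommGroup A] [Module ℂ A] (j : ℕ) (hj : j = 0) :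
    ∃ ψ : (⨂[ℂ]^(j+1) A) →ₗ[ℂ] A, ∀ f, ψ (tp A (j+1) f) = f 0 := by
  subst hj
  refine ⟨PiTensorProduct.lift (MultilinearMap.ofSubsingleton ℂ A A (0 : Fin 1) LinearMap.id), ?_⟩
  intro f
  simp [tp]

theorem aux_slot (A : Type) [AddCommGroup A] [Module ℂ A] (j : ℕ) (h : ℕ → A) :
    ∃ ψ : A →ₗ[ℂ] (⨂[ℂ]^(j+1) A), ∀ g, ψ g = tp A (j+1) (fun t => if t = 0 then g else h t) := by
  refine ⟨(PiTensorProduct.tprod ℂ (s := fun _ : Fin (j+1) => A)).toLinearMap (fun t => h t) 0, ?_⟩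
  intro g
  simp only [MultilinearMap.toLinearMap_apply, tp]
  congr 1
  funext t
  by_cases ht : t = 0
  · subst ht; simp
  · have : t.1 ≠ 0 := fun h => ht (Fin.ext h)
    simp [ht]

/-- `∑ Γ(α_i, c) = 0` for all `c`. -/
def AuxC (n : ℕ) (A : Type) [AddCommGroup A] [Module ℂ A]
    (Γ : MultilinearMap ℂ (fun _ : Fin (n - 1) => A) A) (K : ℕ) {N : ℕ} (α : Fin N → ℕ → A) : Prop :=
  ∀ c : ℕ → A, ∑ i, Γ (fun j : Fin (n - 1) => if j.1 < K then α i j.1 else c (j.1 - K)) = 0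

theorem aux_cyc (n : ℕ) (hn : 3 ≤ n) (A : Type) [AddCommGroup A] [Module ℂ A]
    (Γ : MultilinearMap ℂ (fun _ : Fin (n - 1) => A) A)
    (q₁ : A →ₗ[ℂ] A →ₗ[ℂ] ℂ)
    (hq₁nondeg : ∀ x : A, (∀ y : A, q₁ x y = 0) → x = 0)
    (hinv : ∀ a : ℕ → A,
      q₁ (Γ (fun i : Fin (n - 1) => a i.1)) (a (n - 1)) =
        q₁ (a 0) (Γ (fun i : Fin (n - 1) => a (i.1 + 1))))
    (K : ℕ) {N : ℕ} (α : Fin N → ℕ → A) (hα : AuxC n A Γ K α) (L : ℕ) (hL : L + K ≤ n - 1)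
    (b c : ℕ → A) :
    ∑ i, Γ (fun j : Fin (n - 1) => if j.1 < L then b j.1 else
      if j.1 < L + K then α i (j.1 - L) else c j.1) = 0 := by
  induction L generalizing b c with
  | zero =>
    rw [← hα (fun j => c (j + K))]
    refine Finset.sum_congr rfl fun i _ => ?_
    congr 1
    funext j
    by_cases h : j.1 < K
    · simp [h]
    · simp [h, Nat.sub_add_cancel (Nat.le_of_not_lt h)]
  | succ L ih =>
    apply hq₁nondeg
    intro d
    rw [map_sum, LinearMap.sum_apply]
    have key : ∀ i, q₁ (Γ (fun j : Fin (n - 1) => if j.1 < L + 1 then b j.1 else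
        if j.1 < L + 1 + K then α i (j.1 - (L + 1)) else c j.1)) d =
        q₁ (b 0) (Γ (fun j : Fin (n - 1) => if j.1 < L then b (j.1 + 1) else
          if j.1 < L + K then α i (j.1 - L) else if j.1 + 1 < n - 1 then c (j.1 + 1) else d)) := by
      intro i
      have h := hinv (fun j => if j < n - 1 then (if j < L + 1 then b j else
        if j < L + 1 + K then α i (j - (L + 1)) else c j) else d)
      simp only [lt_irrefl, if_false, Fin.is_lt, if_true, Nat.zero_lt_succ,
        show 0 < n - 1 by omega] at h
      rw [h]
      congr 2
      funext j
      have := j.2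
      split_ifs <;> first | rfl | omega | (congr 1; omega)
    simp only [key]
    rw [← map_sum, ih (by omega) (fun j => b (j+1)) (fun j => if j + 1 < n - 1 then c (j + 1) else d), map_zero]

theorem aux_incl_inj (p : ℕ) (A : Type) [AddCommGroup A] [Module ℂ A] (k : Fin p) :
    Function.Injective (incl p A k) :=
  DirectSum.of_injective (β := fun k : Fin p => ⨂[ℂ]^(k.1 + 1) A) k

theorem aux_mem (n p : ℕ) (hn : 3 ≤ n) (hp : p = n - 2)
    (A : Type) [AddCommGroup A] [Module ℂ A]
    (Γ : MultilinearMap ℂ (fun _ : Fin (n - 1) => A) A)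
    (mul : Mspace p A →ₗ[ℂ] Mspace p A →ₗ[ℂ] Mspace p A)
    (hmul : MulSpec n p A Γ mul) (k : Fin p) (hk : k.1 ≠ 0) {N : ℕ} (α : Fin N → ℕ → A) :
    (∑ i, tp A (k.1+1) (α i)) ∈ Ik p A mul k ↔ AuxC n A Γ (k.1+1) α := by
  have hkp := k.2
  have hlt : p - (k.1 + 1) < p := by omega
  have key : ∀ c, mul (incl p A k (∑ i, tp A (k.1+1) (α i)))
      (incl p A ⟨p - (k.1 + 1), hlt⟩ (tp A (p - (k.1+1) + 1) c)) =
      incl p A ⟨k.1 + (p - (k.1 + 1)) + 1 - p, by omega⟩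
        (∑ i, tp A (k.1 + (p - (k.1 + 1)) + 1 - p + 1) (fun t => if t = 0 then
          Γ (fun j : Fin (n - 1) => if j.1 < k.1 + 1 then α i j.1 else c (j.1 - (k.1 + 1))) 
          else c (p - (k.1 + 1) + t))) := by
    intro c
    simp only [map_sum, LinearMap.sum_apply]
    refine Finset.sum_congr rfl fun i _ => ?_
    have h := hmul k ⟨p - (k.1 + 1), hlt⟩ (α i) c
    rw [dif_neg (by simp only; omega)] at h
    exact h
  simp only [Ik, if_neg hk, Submodule.mem_iInf, LinearMap.mem_ker, LinearMap.comp_apply,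
    LinearMap.flip_apply]
  constructor
  · intro h c
    have h1 := h (tp A _ c)
    rw [key] at h1
    rw [← map_zero (incl p A ⟨k.1 + (p - (k.1 + 1)) + 1 - p, by omega⟩)] at h1
    have h2 := aux_incl_inj p A _ h1
    obtain ⟨ψ, hψ⟩ := aux_proj A (k.1 + (p - (k.1 + 1)) + 1 - p) (by omega)
    have h3 := congrArg ψ h2
    simpa [hψ] using h3
  · intro h y
    obtain ⟨M, γ, rfl⟩ := aux_rep A _ y
    rw [map_sum (incl p A ⟨p - (k.1 + 1), hlt⟩), map_sum (mul _)]
    apply Finset.sum_eq_zero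
    intro m _
    rw [key]
    obtain ⟨ψ, hψ⟩ := aux_slot A (k.1 + (p - (k.1 + 1)) + 1 - p) (fun t => γ m (p - (k.1 + 1) + t))
    simp only [← hψ]
    rw [← map_sum, h, map_zero, map_zero]

theorem aux_Isub (p : ℕ) (A : Type) [AddCommGroup A] [Module ℂ A]
    (mul : Mspace p A →ₗ[ℂ] Mspace p A →ₗ[ℂ] Mspace p A) (k : Fin p) (x)
    (hx : x ∈ Ik p A mul k) : incl p A k x ∈ Isub p A mul :=
  (le_iSup (fun k : Fin p => (Ik p A mul k).map (incl p A k)) k) (Submodule.mem_map_of_mem hx)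

theorem aux_pure (n p : ℕ) (hn : 3 ≤ n) (hp : p = n - 2)
    (A : Type) [AddCommGroup A] [Module ℂ A]
    (Γ : MultilinearMap ℂ (fun _ : Fin (n - 1) => A) A)
    (q₁ : A →ₗ[ℂ] A →ₗ[ℂ] ℂ)
    (hq₁nondeg : ∀ x : A, (∀ y : A, q₁ x y = 0) → x = 0)
    (hinv : ∀ a : ℕ → A,
      q₁ (Γ (fun i : Fin (n - 1) => a i.1)) (a (n - 1)) =
        q₁ (a 0) (Γ (fun i : Fin (n - 1) => a (i.1 + 1))))
    (hassoc : ∀ r s : ℕ, r ≤ n - 2 → s ≤ n - 2 → ∀ a : ℕ → A,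
      gammaIns n A Γ r a = gammaIns n A Γ s a)
    (mul : Mspace p A →ₗ[ℂ] Mspace p A →ₗ[ℂ] Mspace p A)
    (hmul : MulSpec n p A Γ mul) (k l : Fin p) (hk : k.1 ≠ 0) {N : ℕ} (α : Fin N → ℕ → A)
    (hα : AuxC n A Γ (k.1+1) α) (b : ℕ → A) :
    mul (incl p A k (∑ i, tp A (k.1+1) (α i))) (incl p A l (tp A (l.1+1) b)) ∈ Isub p A mul ∧
    mul (incl p A l (tp A (l.1+1) b)) (incl p A k (∑ i, tp A (k.1+1) (α i))) ∈ Isub p A mul := by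
  have hkp := k.2
  have hlp := l.2
  simp only [map_sum, LinearMap.sum_apply, hmul k l, hmul l k]
  by_cases h : (k.1 + 1) + (l.1 + 1) ≤ p
  · have h' : (l.1 + 1) + (k.1 + 1) ≤ p := by omega
    simp only [dif_pos h, dif_pos h']
    rw [← map_sum, ← map_sum]
    constructor
    · apply aux_Isub
      refine (aux_mem n p hn hp A Γ mul hmul ⟨k.1 + l.1 + 1, by omega⟩ (by simp) _).2 ?_
      intro c
      rw [← hα (fun t => if t < l.1 + 1 then b t else c (t - (l.1 + 1)))]
      refine Finset.sum_congr rfl fun i _ => ?_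
      congr 1
      funext j
      simp only
      split_ifs <;> first | rfl | omega | (congr 1; omega)
    · apply aux_Isub
      refine (aux_mem n p hn hp A Γ mul hmul ⟨l.1 + k.1 + 1, by omega⟩ (by simp) _).2 ?_
      intro c
      rw [← aux_cyc n hn A Γ q₁ hq₁nondeg hinv (k.1+1) α hα (l.1+1) (by omega) b
        (fun t => c (t - (l.1 + k.1 + 1 + 1)))]
      refine Finset.sum_congr rfl fun i _ => ?_
      congr 1
      funext j
      simp only
      split_ifs <;> first | rfl | omega | (congr 1; omega)
  · have h' : ¬ (l.1 + 1) + (k.1 + 1) ≤ p := by omega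
    simp only [dif_neg h, dif_neg h']
    rw [← map_sum, ← map_sum]
    constructor
    · obtain ⟨ψ, hψ⟩ := aux_slot A (k.1 + l.1 + 1 - p) (fun t => b (p - (k.1 + 1) + t))
      simp only [← hψ]
      rw [← map_sum, hα, map_zero, map_zero]
      exact zero_mem _
    · by_cases h0 : l.1 + k.1 + 1 - p = 0
      · have hz : ∑ i, tp A (l.1 + k.1 + 1 - p + 1) (fun t => if t = 0 then
            Γ (fun j : Fin (n - 1) => if j.1 < l.1 + 1 then b j.1 else α i (j.1 - (l.1 + 1)))
            else α i (p - (l.1 + 1) + t)) = 0 := by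
          obtain ⟨ψ, hψ⟩ := aux_slot A (l.1 + k.1 + 1 - p) (fun t => 0)
          have e : ∀ i, tp A (l.1 + k.1 + 1 - p + 1) (fun t => if t = 0 then
            Γ (fun j : Fin (n - 1) => if j.1 < l.1 + 1 then b j.1 else α i (j.1 - (l.1 + 1)))
            else α i (p - (l.1 + 1) + t)) = ψ (Γ (fun j : Fin (n - 1) => if j.1 < l.1 + 1 then b j.1 else
              if j.1 < l.1 + 1 + (k.1 + 1) then α i (j.1 - (l.1 + 1)) else 0)) := by
            intro i
            rw [hψ]
            unfold tp
            congr 1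
            funext t
            have ht := t.2
            have ht0 : t.1 = 0 := by omega
            simp only [ht0, if_true]
            congr 1
            funext j
            have hj := j.2
            rw [if_pos (show j.1 < l.1 + 1 + (k.1 + 1) by omega)]
          simp only [e]
          rw [← map_sum, aux_cyc n hn A Γ q₁ hq₁nondeg hinv (k.1+1) α hα (l.1+1) (by omega) b
            (fun _ => 0), map_zero]
        rw [hz, map_zero]
        exact zero_mem _
      · apply aux_Isub
        refine (aux_mem n p hn hp A Γ mul hmul ⟨l.1 + k.1 + 1 - p, by omega⟩ h0 _).2 ?_
        intro c
        have hL : l.1 + 1 < n - 1 := by omega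
        set W : Fin N → ℕ → A := fun i j => if j < l.1 + 1 then b j else
          if j < l.1 + 1 + (k.1 + 1) then α i (j - (l.1 + 1)) else
            c (j - (l.1 + 1 + (k.1 + 1))) with hW
        have e1 : ∀ i, Γ (fun j : Fin (n - 1) => if j.1 < l.1 + k.1 + 1 - p + 1 then
            (if j.1 = 0 then Γ (fun j : Fin (n - 1) =>
              if j.1 < l.1 + 1 then b j.1 else α i (j.1 - (l.1 + 1)))
            else α i (p - (l.1 + 1) + j.1)) else c (j.1 - (l.1 + k.1 + 1 - p + 1))) =
            gammaIns n A Γ 0 (W i) := by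
          intro i
          unfold gammaIns
          congr 1
          funext j
          have hj := j.2
          by_cases hj0 : j.1 = 0
          · rw [if_pos (by omega), if_pos hj0, if_neg (by omega), if_pos hj0]
            congr 1
            funext t
            have ht := t.2
            simp only [hW, Nat.zero_add]
            split_ifs <;> first | rfl | omega
          · rw [if_neg (Nat.not_lt_zero _)]
            simp only [hj0, if_false, hW]
            split_ifs <;> first | rfl | omega | (congr 1; omega)
        have e2 : ∀ i, gammaIns n A Γ (l.1 + 1) (W i) =
            Γ.toLinearMap (fun j : Fin (n - 1) => if j.1 < l.1 + 1 then b j.1 else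
              c (j.1 + (n - 2) - (l.1 + 1 + (k.1 + 1)))) ⟨l.1 + 1, hL⟩
              (Γ (fun j : Fin (n - 1) => if j.1 < k.1 + 1 then α i j.1 else
                c (j.1 - (k.1 + 1)))) := by
          intro i
          unfold gammaIns
          rw [MultilinearMap.toLinearMap_apply]
          congr 1
          funext j
          have hj := j.2
          by_cases hjl : j = ⟨l.1 + 1, hL⟩
          · subst hjl
            simp only [lt_irrefl, if_false, if_true, Function.update_self]
            congr 1
            funext t
            have ht := t.2
            simp only [hW]
            split_ifs <;> first | rfl | omega | (congr 1; omega)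
          · have hjl' : j.1 ≠ l.1 + 1 := fun h => hjl (Fin.ext h)
            rw [Function.update_of_ne hjl]
            simp only [hjl', if_false, hW]
            split_ifs <;> first | rfl | omega
        refine (Finset.sum_congr rfl fun i _ => (e1 i).trans
          ((hassoc 0 (l.1 + 1) (by omega) (by omega) (W i)).trans (e2 i))).trans ?_
        rw [← map_sum, hα, map_zero]

/-- The subspace `I = ⊕_{k=1}^{p} I_k` is a two-sided ideal of the
(generally non-associative) algebra `M`: for all `a ∈ I` and `b ∈ M`, both `a·b ∈ I`
and `b·a ∈ I`. -/
theorem Isub_is_two_sided_ideal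
    (n p : ℕ) (hn : 3 ≤ n) (hp : p = n - 2)
    (A : Type) [AddCommGroup A] [Module ℂ A] [FiniteDimensional ℂ A]
    (Γ : MultilinearMap ℂ (fun _ : Fin (n - 1) => A) A)
    (q₁ : A →ₗ[ℂ] A →ₗ[ℂ] ℂ)
    (hq₁symm : ∀ x y : A, q₁ x y = q₁ y x)
    (hq₁nondeg : ∀ x : A, (∀ y : A, q₁ x y = 0) → x = 0)
    (hinv : ∀ a : ℕ → A,
      q₁ (Γ (fun i : Fin (n - 1) => a i.1)) (a (n - 1)) =
        q₁ (a 0) (Γ (fun i : Fin (n - 1) => a (i.1 + 1))))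
    (hassoc : ∀ r s : ℕ, r ≤ n - 2 → s ≤ n - 2 → ∀ a : ℕ → A,
      gammaIns n A Γ r a = gammaIns n A Γ s a)
    (mul : Mspace p A →ₗ[ℂ] Mspace p A →ₗ[ℂ] Mspace p A)
    (hmul : MulSpec n p A Γ mul)
    :
    ∀ a ∈ Isub p A mul, ∀ b : Mspace p A,
      mul a b ∈ Isub p A mul ∧ mul b a ∈ Isub p A mul := by
  intro a ha b
  unfold Isub at ha
  induction ha using Submodule.iSup_induction' with
  | zero => simp
  | add x y _ _ hx hy =>
    simp only [map_add, LinearMap.add_apply]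
    exact ⟨add_mem hx.1 hy.1, add_mem hx.2 hy.2⟩
  | mem k z hz =>
    obtain ⟨x, hx, rfl⟩ := hz
    by_cases hk : k.1 = 0
    · have hx0 : x = 0 := by
        have hx' : x ∈ Ik p A mul k := hx
        simpa only [Ik, if_pos hk, Submodule.mem_bot] using hx'
      subst hx0
      simp
    · obtain ⟨N, α, rfl⟩ := aux_rep A _ x
      have hα := (aux_mem n p hn hp A Γ mul hmul k hk α).1 hx
      induction b using DirectSum.induction_on with
      | zero => simp
      | add x y hx hy =>
        simp only [map_add, LinearMap.add_apply]
        exact ⟨add_mem hx.1 hy.1, add_mem hx.2 hy.2⟩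
      | of l y =>
        obtain ⟨M, γ, rfl⟩ := aux_rep A _ y
        change mul _ (incl p A l _) ∈ _ ∧ mul (incl p A l _) _ ∈ _
        have hh := fun m => aux_pure n p hn hp A Γ q₁ hq₁nondeg hinv hassoc mul hmul k l hk α hα (γ m)
        rw [map_sum (incl p A l), map_sum, map_sum mul, LinearMap.sum_apply]
        exact ⟨sum_mem fun m _ => (hh m).1, sum_mem fun m _ => (hh m).2⟩
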